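/- Under the stated setup, assume 0 < δ < 1, that for every k the matrix φ₂^k is nonexpansive (‖φ₂^k x‖ ≤ ‖x‖ for all x ∈ ℝ^{N₂}), and that the upper JL inequality holds for every k: ‖φ₂^k (I₂ₖ − A^k I₁)‖ ≤ (1+δ)‖I₂ₖ − A^k I₁‖. Then the compressed-domain data cost is bounded above by E_d ≤ (1+δ)² Ẽ_d + C_u, where C_u = η² + 2(1+δ) α η. (Upper bound of Proposition 1.) -/

import Mathlib

open Matrix Finset

theorem sum_mul_le_sum_mul_sum_of_nonneg {ι : Type*} (s : Finset ι) (a b : ι → ℝ)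
    (ha : ∀ i, 0 ≤ a i) (hb : ∀ i, 0 ≤ b i) :
    ∑ i ∈ s, a i * b i ≤ (∑ i ∈ s, a i) * ∑ i ∈ s, b i := by
  rw [Finset.sum_mul]
  exact Finset.sum_le_sum fun i hi =>
    mul_le_mul_of_nonneg_left (Finset.single_le_sum (fun j _ => hb j) hi) (ha i)

theorem sum_sq_le_of_le_mul_add {ι : Type*} (s : Finset ι) (a b c : ι → ℝ) {L : ℝ} (hL : 0 ≤ L)
    (ha : ∀ i, 0 ≤ a i) (hb : ∀ i, 0 ≤ b i) (hc : ∀ i, 0 ≤ c i)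
    (h : ∀ i, c i ≤ L * a i + b i) :
    ∑ i ∈ s, c i ^ 2 ≤ L ^ 2 * (∑ i ∈ s, a i ^ 2)
      + ((∑ i ∈ s, b i) ^ 2 + 2 * L * (∑ i ∈ s, a i) * (∑ i ∈ s, b i)) := by
  have hbb := sum_mul_le_sum_mul_sum_of_nonneg s b b hb hb
  have hab := mul_le_mul_of_nonneg_left (sum_mul_le_sum_mul_sum_of_nonneg s a b ha hb)
    (by positivity : 0 ≤ 2 * L)
  calc ∑ i ∈ s, c i ^ 2 ≤ ∑ i ∈ s, (L * a i + b i) ^ 2 :=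
        Finset.sum_le_sum fun i _ => pow_le_pow_left₀ (hc i) (h i) 2
    _ = L ^ 2 * (∑ i ∈ s, a i ^ 2) + (∑ i ∈ s, b i * b i + 2 * L * ∑ i ∈ s, a i * b i) := by
        simp only [Finset.mul_sum, ← Finset.sum_add_distrib]
        exact Finset.sum_congr rfl fun i _ => by ring
    _ ≤ _ := by linarith

/-- Upper bound of Proposition 1: `E_d ≤ (1+δ)² Ẽ_d + C_u` with
`C_u = η² + 2(1+δ) α η`. -/
theorem prop1_upper_bound
    (N₁ N₂ N M K : ℕ) (hN₁ : 0 < N₁) (hN₂ : 0 < N₂) (hN : 0 < N) (hM : 0 < M) (hK : 0 < K)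
    (A : Fin N₁ → Matrix (Fin N₂) (Fin N) ℝ)
    (φ₂ : Fin N₁ → Matrix (Fin M) (Fin N₂) ℝ)
    (Φ₁ : Matrix (Fin K) (Fin N) ℝ)
    (I₁ : EuclideanSpace ℝ (Fin N))
    (I₂ : Fin N₁ → EuclideanSpace ℝ (Fin N₂))
    (δ : ℝ) (hδ0 : 0 < δ) (hδ1 : δ < 1)
    (hnonexp : ∀ (k : Fin N₁) (x : EuclideanSpace ℝ (Fin N₂)),
      ‖Matrix.toEuclideanLin (φ₂ k) x‖ ≤ ‖x‖)
    (hJL : ∀ k : Fin N₁,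
      ‖Matrix.toEuclideanLin (φ₂ k) (I₂ k - Matrix.toEuclideanLin (A k) I₁)‖
        ≤ (1 + δ) * ‖I₂ k - Matrix.toEuclideanLin (A k) I₁‖) :
    -- `E_d ≤ (1+δ)² Ẽ_d + (η² + 2(1+δ) α η)`
    ∑ k : Fin N₁, ‖Matrix.toEuclideanLin (φ₂ k) (I₂ k) -
        Matrix.toEuclideanLin (φ₂ k * A k * Φ₁ᵀ * Φ₁) I₁‖ ^ 2
      ≤ (1 + δ) ^ 2 * (∑ k : Fin N₁, ‖I₂ k - Matrix.toEuclideanLin (A k) I₁‖ ^ 2)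
        + ((∑ k : Fin N₁,
              ‖Matrix.toEuclideanLin (A k) (Matrix.toEuclideanLin (Φ₁ᵀ * Φ₁) I₁ - I₁)‖) ^ 2
          + 2 * (1 + δ) * (∑ k : Fin N₁, ‖I₂ k - Matrix.toEuclideanLin (A k) I₁‖)
            * (∑ k : Fin N₁,
                ‖Matrix.toEuclideanLin (A k) (Matrix.toEuclideanLin (Φ₁ᵀ * Φ₁) I₁ - I₁)‖)) := by
  refine sum_sq_le_of_le_mul_add _ _ _ _ (by linarith) (fun _ => norm_nonneg _)
    (fun _ => norm_nonneg _) (fun _ => norm_nonneg _) fun k => ?_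
  have hsplit : Matrix.toEuclideanLin (φ₂ k) (I₂ k) -
        Matrix.toEuclideanLin (φ₂ k * A k * Φ₁ᵀ * Φ₁) I₁
      = Matrix.toEuclideanLin (φ₂ k) (I₂ k - Matrix.toEuclideanLin (A k) I₁)
        - Matrix.toEuclideanLin (φ₂ k)
          (Matrix.toEuclideanLin (A k) (Matrix.toEuclideanLin (Φ₁ᵀ * Φ₁) I₁ - I₁)) := by
    have hmul : Matrix.toEuclideanLin (φ₂ k * A k * Φ₁ᵀ * Φ₁) I₁
        = Matrix.toEuclideanLin (φ₂ k)
          (Matrix.toEuclideanLin (A k) (Matrix.toEuclideanLin (Φ₁ᵀ * Φ₁) I₁)) := by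
      simp [Matrix.toLpLin_apply, Matrix.mulVec_mulVec, Matrix.mul_assoc]
    rw [hmul]
    simp only [map_sub]
    abel
  rw [hsplit]
  exact (norm_sub_le _ _).trans (add_le_add (hJL k) (hnonexp k _))
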